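/- arXiv:1010.4788 — 2 statements merged into one kernel-verified Lean document; each statement's English description precedes it below -/
import Mathlib

section
/- Every Borel set A ⊆ ∂T can be written as a countable disjoint union A = ⨆_i A_i of Borel sets such that the restriction of Λ to each A_i is injective; moreover, for every Borel set A ⊆ ∂T, the image Λ(A) is a Borel subset of X. -/
open MeasureTheory Set
open scoped ENNReal

/-- A bounded metric measure space `(X, ρ, m)` is Ahlfors `Q`-regular with constants
`c₁ ≤ c₂` if `c₁ r^Q ≤ m(B(x,r)) ≤ c₂ r^Q` for all `x ∈ X` and `0 < r ≤ diam X`. -/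
def IsAhlfors {X : Type} [MetricSpace X] [MeasurableSpace X]
    (m : Measure X) (c₁ c₂ Qd : ℝ) : Prop :=
  ∀ (x : X) (r : ℝ), 0 < r → r ≤ Metric.diam (Set.univ : Set X) →
    ENNReal.ofReal (c₁ * r ^ Qd) ≤ m (Metric.ball x r) ∧
      m (Metric.ball x r) ≤ ENNReal.ofReal (c₂ * r ^ Qd)

/-- A Christ dyadic decomposition of the metric measure space `(X, ρ, m)`. -/
structure ChristDecomposition {X : Type} [MetricSpace X] [MeasurableSpace X]
    (m : Measure X) where
  δ : ℝ
  c₄ : ℝ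
  δ_pos : 0 < δ
  δ_lt_one : δ < 1
  c₄_pos : 0 < c₄
  I : ℕ → Type
  countableI : ∀ k : ℕ, Countable (I k)
  Qs : (k : ℕ) → I k → Set X
  z : (k : ℕ) → I k → X
  isOpenQs : ∀ (k : ℕ) (α : I k), IsOpen (Qs k α)
  root : I 0
  root_unique : ∀ a : I 0, a = root
  root_box : Qs 0 root = Set.univ
  ae_cover : ∀ k : ℕ, m ((⋃ α : I k, Qs k α)ᶜ) = 0
  nested : ∀ ⦃k l : ℕ⦄, k ≤ l → ∀ (α : I k) (β : I l),
      Qs l β ⊆ Qs k α ∨ Disjoint (Qs l β) (Qs k α)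
  parent_unique : ∀ ⦃k l : ℕ⦄, k < l → ∀ β : I l, ∃! α : I k, Qs l β ⊆ Qs k α
  diam_le : ∀ (k : ℕ) (α : I k), Metric.diam (Qs k α) ≤ c₄ * δ ^ k
  ball_subset : ∀ (k : ℕ) (α : I k), Metric.ball (z k α) (δ ^ k) ⊆ Qs k α
  z_mem : ∀ (k : ℕ) (α : I k), z k α ∈ Qs k α

namespace ChristDecomposition

variable {X : Type} [MetricSpace X] [MeasurableSpace X] {m : Measure X}

/-- The vertices of the graph/tree: pairs `(k, α)` with `α ∈ I_k`. -/
def Idx (D : ChristDecomposition m) : Type := Σ k : ℕ, D.I k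

/-- G-adjacency of two indices: either they are at consecutive levels and one of the
corresponding dyadic sets contains the other, or they are at the same level `k` and the
corresponding dyadic sets contain points at distance `≤ δ^k`. -/
def GAdj (D : ChristDecomposition m) (a b : D.Idx) : Prop :=
  a ≠ b ∧
    (((a.1 = b.1 + 1 ∨ b.1 = a.1 + 1) ∧
        (D.Qs a.1 a.2 ⊆ D.Qs b.1 b.2 ∨ D.Qs b.1 b.2 ⊆ D.Qs a.1 a.2)) ∨
      (a.1 = b.1 ∧ ∃ x ∈ D.Qs a.1 a.2, ∃ y ∈ D.Qs b.1 b.2, dist x y ≤ D.δ ^ a.1))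

/-- A branch of the tree: a sequence of nested dyadic sets, one at each level.
This is the boundary `∂T` of the tree `T`. -/
def Branch (D : ChristDecomposition m) : Type :=
  { ξ : (k : ℕ) → D.I k // ∀ k : ℕ, D.Qs (k + 1) (ξ (k + 1)) ⊆ D.Qs k (ξ k) }

-- The map `Λ : ∂T → X` sending a branch to the unique point of `⋂_k closure (Q^k_{ξ_k})`.
open Classical in
noncomputable def Lam (D : ChristDecomposition m) (ξ : D.Branch) : X :=
  if h : (⋂ k : ℕ, closure (D.Qs k (ξ.1 k))).Nonempty then h.choose
  else D.z 0 D.root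

-- The metric `ρ_T` on `∂T`: `ρ_T(ζ,ξ) = (2δ/(1-δ)) δ^{n(ζ,ξ)}`, `n(ζ,ξ) = max {k | ζ_k = ξ_k}`.
open Classical in
noncomputable def rhoT (D : ChristDecomposition m) (ζ ξ : D.Branch) : ℝ :=
  if ζ = ξ then 0
  else (2 * D.δ / (1 - D.δ)) * D.δ ^ sSup {k : ℕ | ζ.1 k = ξ.1 k}

/-- The cylinder `∂S(α) ⊆ ∂T` of branches passing through `α ∈ I_k`. -/
def cyl (D : ChristDecomposition m) (k : ℕ) (α : D.I k) : Set D.Branch :=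
  {ξ : D.Branch | ξ.1 k = α}

/-- `P_G(x)`: the set of indices `α` with `x ∈ closure Q_α`, or `α` G-adjacent to some `β`
with `x ∈ closure Q_β`. -/
def PG (D : ChristDecomposition m) (x : X) : Set D.Idx :=
  {a : D.Idx | x ∈ closure (D.Qs a.1 a.2) ∨
    ∃ b : D.Idx, D.GAdj a b ∧ x ∈ closure (D.Qs b.1 b.2)}

/-- `I_G ω(x) = Σ_{α ∈ P_G(x)} ω(α) m(α)^{-s}`. -/
noncomputable def IG (D : ChristDecomposition m) (s : ℝ) (ω : Measure X) (x : X) : ℝ≥0∞ :=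
  ∑' a : D.PG x, ω (closure (D.Qs a.1.1 a.1.2)) * m (D.Qs a.1.1 a.1.2) ^ (-s)

/-- `S_G ω(x) = sup_{α ∈ P_G(x)} ω(α) m(α)^{-s}`. -/
noncomputable def SG (D : ChristDecomposition m) (s : ℝ) (ω : Measure X) (x : X) : ℝ≥0∞ :=
  ⨆ (a : D.Idx) (_ : a ∈ D.PG x), ω (closure (D.Qs a.1 a.2)) * m (D.Qs a.1 a.2) ^ (-s)

end ChristDecomposition

-- The Riesz-type kernel `K(x,y) = (m(B(x,ρ(x,y))) + m(B(y,ρ(x,y))))^{-s}`, `K(x,x) = ∞`.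
open Classical in
noncomputable def Kker {Y : Type} [MetricSpace Y] [MeasurableSpace Y]
    (μ : Measure Y) (s : ℝ) (x y : Y) : ℝ≥0∞ :=
  if x = y then ⊤
  else (μ (Metric.ball x (dist x y)) + μ (Metric.ball y (dist x y))) ^ (-s)

/-- The potential `Kω(x) = ∫ K(x,y) dω(y)`. -/
noncomputable def Kpot {Y : Type} [MetricSpace Y] [MeasurableSpace Y]
    (μ : Measure Y) (s : ℝ) (ω : Measure Y) (x : Y) : ℝ≥0∞ :=
  ∫⁻ y, Kker μ s x y ∂ω

/-- The `p`-energy `E(ω) = ∫ (Kω)^{p'} dm`, `p' = p/(p-1)`. -/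
noncomputable def energyX {Y : Type} [MetricSpace Y] [MeasurableSpace Y]
    (μ : Measure Y) (s p : ℝ) (ω : Measure Y) : ℝ≥0∞ :=
  ∫⁻ x, Kpot μ s ω x ^ (p / (p - 1)) ∂μ

/-- The `p`-capacity `Cap(E) = sup { ω(E)^p / E(ω)^{p-1} }`, the supremum being over positive
Borel measures supported in `E` with finite positive energy. -/
noncomputable def CapX {Y : Type} [MetricSpace Y] [MeasurableSpace Y]
    (μ : Measure Y) (s p : ℝ) (E : Set Y) : ℝ≥0∞ :=
  ⨆ (ω : Measure Y) (_ : ω Eᶜ = 0) (_ : 0 < energyX μ s p ω)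
    (_ : energyX μ s p ω < ⊤), ω E ^ p / energyX μ s p ω ^ (p - 1)

section

open Filter Topology

lemma isBounded_univ_of_diam_pos {X : Type*} [PseudoMetricSpace X]
    (h : 0 < Metric.diam (univ : Set X)) : Bornology.IsBounded (univ : Set X) := by
  by_contra hb
  exact h.ne' (Metric.diam_eq_zero_of_unbounded hb)

namespace ChristDecomposition

section Boxes

variable {X : Type} [MetricSpace X] [MeasurableSpace X] {m : Measure X} {c₁ c₂ Qd : ℝ}

lemma measure_ball_pos (hc₁ : 0 < c₁)
    (hdiam : 0 < Metric.diam (univ : Set X)) (hreg : IsAhlfors m c₁ c₂ Qd)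
    (x : X) {r : ℝ} (hr : 0 < r) : 0 < m (Metric.ball x r) := by
  have hs : 0 < min r (Metric.diam (univ : Set X)) := lt_min hr hdiam
  calc 0 < ENNReal.ofReal (c₁ * min r (Metric.diam (univ : Set X)) ^ Qd) :=
        ENNReal.ofReal_pos.2 (mul_pos hc₁ (Real.rpow_pos_of_pos hs _))
    _ ≤ m (Metric.ball x (min r (Metric.diam (univ : Set X)))) :=
        (hreg x _ hs (min_le_right _ _)).1
    _ ≤ m (Metric.ball x r) := measure_mono (Metric.ball_subset_ball (min_le_left _ _))

variable (D : ChristDecomposition m)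

lemma exists_child (hc₁ : 0 < c₁)
    (hdiam : 0 < Metric.diam (univ : Set X)) (hreg : IsAhlfors m c₁ c₂ Qd)
    (k : ℕ) (α : D.I k) : ∃ γ : D.I (k + 1), D.Qs (k + 1) γ ⊆ D.Qs k α := by
  by_contra! hno
  have hdisj : ∀ γ : D.I (k + 1), Disjoint (D.Qs (k + 1) γ) (D.Qs k α) := fun γ =>
    (D.nested k.le_succ α γ).resolve_left (hno γ)
  have hsub : D.Qs k α ⊆ (⋃ γ : D.I (k + 1), D.Qs (k + 1) γ)ᶜ := by
    intro x hx hx'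
    obtain ⟨γ, hγ⟩ := mem_iUnion.1 hx'
    exact (Set.disjoint_left.1 (hdisj γ)) hγ hx
  have hpos := measure_ball_pos hc₁ hdiam hreg (D.z k α) (pow_pos D.δ_pos k)
  exact hpos.ne' (measure_mono_null ((D.ball_subset k α).trans hsub) (D.ae_cover (k + 1)))

lemma eq_of_subset (hc₁ : 0 < c₁)
    (hdiam : 0 < Metric.diam (univ : Set X)) (hreg : IsAhlfors m c₁ c₂ Qd)
    {k : ℕ} {α β : D.I k} (h : D.Qs k β ⊆ D.Qs k α) : α = β := by
  obtain ⟨γ, hγ⟩ := D.exists_child hc₁ hdiam hreg k β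
  exact (D.parent_unique k.lt_succ_self γ).unique (hγ.trans h) hγ

lemma disjoint_of_ne (hc₁ : 0 < c₁)
    (hdiam : 0 < Metric.diam (univ : Set X)) (hreg : IsAhlfors m c₁ c₂ Qd)
    {k : ℕ} {α β : D.I k} (h : α ≠ β) : Disjoint (D.Qs k α) (D.Qs k β) :=
  (D.nested le_rfl β α).resolve_left fun hs => h (D.eq_of_subset hc₁ hdiam hreg hs).symm

/-- Volume count: a ball of radius `R` contains at most `c₂ R^Q / (c₁ r^Q)` boxes of level `k`,
whenever `r ≤ δ^k`. -/
lemma card_mul_le [OpensMeasurableSpace X] (hc₁ : 0 < c₁) (hc₂ : 0 ≤ c₂)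
    (hdiam : 0 < Metric.diam (univ : Set X)) (hreg : IsAhlfors m c₁ c₂ Qd)
    {k : ℕ} {r R : ℝ} (hr : 0 < r) (hrk : r ≤ D.δ ^ k) (hrd : r ≤ Metric.diam (univ : Set X))
    (hR : 0 < R) (hRd : R ≤ Metric.diam (univ : Set X)) (x : X) (s : Finset (D.I k))
    (hs : ∀ α ∈ s, D.Qs k α ⊆ Metric.ball x R) :
    (s.card : ℝ) * (c₁ * r ^ Qd) ≤ c₂ * R ^ Qd := by
  have hball : ∀ α : D.I k, Metric.ball (D.z k α) r ⊆ D.Qs k α := fun α =>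
    (Metric.ball_subset_ball hrk).trans (D.ball_subset k α)
  have hpd : (s : Set (D.I k)).PairwiseDisjoint (fun α => Metric.ball (D.z k α) r) :=
    fun α _ β _ hne => (D.disjoint_of_ne hc₁ hdiam hreg hne).mono (hball α) (hball β)
  have key : (s.card : ℝ≥0∞) * ENNReal.ofReal (c₁ * r ^ Qd) ≤ ENNReal.ofReal (c₂ * R ^ Qd) := by
    calc (s.card : ℝ≥0∞) * ENNReal.ofReal (c₁ * r ^ Qd)
        = ∑ _α ∈ s, ENNReal.ofReal (c₁ * r ^ Qd) := by simp
      _ ≤ ∑ α ∈ s, m (Metric.ball (D.z k α) r) :=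
          Finset.sum_le_sum fun α _ => (hreg _ r hr hrd).1
      _ = m (⋃ α ∈ s, Metric.ball (D.z k α) r) :=
          (measure_biUnion_finset hpd fun _ _ => Metric.isOpen_ball.measurableSet).symm
      _ ≤ m (Metric.ball x R) :=
          measure_mono (iUnion₂_subset fun α hα => (hball α).trans (hs α hα))
      _ ≤ _ := (hreg x R hR hRd).2
  rw [← ENNReal.ofReal_natCast, ← ENNReal.ofReal_mul (Nat.cast_nonneg _)] at key
  exact (ENNReal.ofReal_le_ofReal_iff (mul_nonneg hc₂ (Real.rpow_nonneg hR.le _))).1 key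

/-- Only finitely many boxes of a given level lie in a small ball. -/
lemma finite_boxes [OpensMeasurableSpace X] (hc₁ : 0 < c₁) (hc₂ : 0 ≤ c₂)
    (hdiam : 0 < Metric.diam (univ : Set X)) (hreg : IsAhlfors m c₁ c₂ Qd)
    {R : ℝ} (hR : 0 < R) (hRd : R ≤ Metric.diam (univ : Set X)) (x : X) (k : ℕ) :
    {α : D.I k | D.Qs k α ⊆ Metric.ball x R}.Finite := by
  by_contra hinf
  set r := min (D.δ ^ k) (Metric.diam (univ : Set X))
  have hr : 0 < r := lt_min (pow_pos D.δ_pos k) hdiam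
  have hv : 0 < c₁ * r ^ Qd := mul_pos hc₁ (Real.rpow_pos_of_pos hr _)
  obtain ⟨n, hn⟩ := exists_nat_gt (c₂ * R ^ Qd / (c₁ * r ^ Qd))
  obtain ⟨s, hs, hcard⟩ := Set.Infinite.exists_subset_card_eq hinf n
  have := D.card_mul_le hc₁ hc₂ hdiam hreg hr (min_le_left _ _) (min_le_right _ _) hR hRd x s
    (fun α hα => hs hα)
  rw [hcard] at this
  exact absurd ((div_lt_iff₀ hv).1 hn) (not_lt.2 this)

lemma dist_le_of_mem_closure (hdiam : 0 < Metric.diam (univ : Set X)) {k : ℕ} {α : D.I k}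
    {x y : X} (hx : x ∈ closure (D.Qs k α)) (hy : y ∈ closure (D.Qs k α)) :
    dist x y ≤ D.c₄ * D.δ ^ k := by
  have hb : Bornology.IsBounded (closure (D.Qs k α)) :=
    (isBounded_univ_of_diam_pos hdiam).subset (subset_univ _)
  exact (Metric.dist_le_diam_of_mem hb hx hy).trans
    ((Metric.diam_closure _).le.trans (D.diam_le k α))

lemma tendsto_scale (c : ℝ) : Tendsto (fun k : ℕ => c * D.δ ^ k) atTop (𝓝 0) := by
  simpa using (tendsto_pow_atTop_nhds_zero_of_lt_one D.δ_pos.le D.δ_lt_one).const_mul c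

end Boxes

section Branches

variable {X : Type} [MetricSpace X] [MeasurableSpace X] {m : Measure X}
variable (D : ChristDecomposition m)

lemma Branch.antitone {D : ChristDecomposition m} (ξ : D.Branch) :
    Antitone fun k => D.Qs k (ξ.1 k) :=
  antitone_nat_of_succ_le ξ.2

lemma Branch.eq_of_le {D : ChristDecomposition m} {ξ ζ : D.Branch} {j k : ℕ} (hjk : j ≤ k)
    (h : ξ.1 k = ζ.1 k) : ξ.1 j = ζ.1 j := by
  rcases hjk.eq_or_lt with rfl | hlt
  · exact h
  · refine (D.parent_unique hlt (ξ.1 k)).unique (ξ.antitone hjk) ?_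
    rw [h]
    exact ζ.antitone hjk

lemma Branch.exists_ne {D : ChristDecomposition m} {ξ ζ : D.Branch} (h : ξ ≠ ζ) :
    ∃ n, ξ.1 n ≠ ζ.1 n := by
  by_contra! hall
  exact h (Subtype.ext (funext hall))

lemma Lam_mem_closure [CompleteSpace X] (hdiam : 0 < Metric.diam (univ : Set X))
    (ξ : D.Branch) (k : ℕ) : D.Lam ξ ∈ closure (D.Qs k (ξ.1 k)) := by
  have hne : (⋂ k : ℕ, closure (D.Qs k (ξ.1 k))).Nonempty := by
    refine Metric.nonempty_iInter_of_nonempty_biInter (fun _ => isClosed_closure)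
      (fun _ => (isBounded_univ_of_diam_pos hdiam).subset (subset_univ _)) (fun N => ?_) ?_
    · exact ⟨D.z N (ξ.1 N), mem_iInter₂.2 fun n hn =>
        subset_closure (ξ.antitone hn (D.z_mem N (ξ.1 N)))⟩
    · refine squeeze_zero (fun _ => Metric.diam_nonneg) (fun k => ?_) (D.tendsto_scale D.c₄)
      exact (Metric.diam_closure _).le.trans (D.diam_le k _)
  have hL : D.Lam ξ ∈ ⋂ k : ℕ, closure (D.Qs k (ξ.1 k)) := by
    rw [Lam, dif_pos hne]
    exact hne.choose_spec
  exact mem_iInter.1 hL k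

variable {c₁ c₂ Qd : ℝ}

/-- Every fibre of `Λ` is finite. -/
lemma finite_fiber [OpensMeasurableSpace X] [CompleteSpace X] (hc₁ : 0 < c₁) (hc₂ : 0 ≤ c₂)
    (hdiam : 0 < Metric.diam (univ : Set X)) (hreg : IsAhlfors m c₁ c₂ Qd) (x : X) :
    {ξ : D.Branch | D.Lam ξ = x}.Finite := by
  classical
  by_contra hinf
  have hc4 := D.c₄_pos
  obtain ⟨N, hN⟩ := exists_nat_gt (c₂ * (2 * D.c₄) ^ Qd / c₁)
  obtain ⟨s, hs, hcard⟩ := Set.Infinite.exists_subset_card_eq hinf N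
  have hsep : ∀ᶠ k in atTop, ∀ p ∈ s ×ˢ s, p.1 ≠ p.2 → p.1.1 k ≠ p.2.1 k := by
    rw [Filter.eventually_all_finset]
    rintro ⟨ξ, ζ⟩ -
    by_cases h : ξ = ζ
    · exact Eventually.of_forall fun _ hne => absurd h hne
    · obtain ⟨n, hn⟩ := Branch.exists_ne h
      filter_upwards [eventually_ge_atTop n] with k hk _ he
      exact hn (Branch.eq_of_le hk he)
  have h1 : ∀ᶠ k in atTop, 1 * D.δ ^ k < Metric.diam (univ : Set X) :=
    (D.tendsto_scale 1).eventually_lt_const hdiam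
  have h2 : ∀ᶠ k in atTop, (2 * D.c₄) * D.δ ^ k < Metric.diam (univ : Set X) :=
    (D.tendsto_scale (2 * D.c₄)).eventually_lt_const hdiam
  obtain ⟨k, hk, hk1, hk2⟩ := (hsep.and (h1.and h2)).exists
  rw [one_mul] at hk1
  have hδ := pow_pos D.δ_pos k
  have hcard' : (s.image fun ξ => ξ.1 k).card = N := by
    rw [Finset.card_image_of_injOn, hcard]
    intro ξ hξ ζ hζ he
    by_contra hne
    exact hk (ξ, ζ) (Finset.mk_mem_product hξ hζ) hne he
  have hle := D.card_mul_le hc₁ hc₂ hdiam hreg hδ le_rfl hk1.le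
    (by positivity : 0 < (2 * D.c₄) * D.δ ^ k) hk2.le x (s.image fun ξ => ξ.1 k) (by
      intro α hα y hy
      obtain ⟨ξ, hξ, rfl⟩ := Finset.mem_image.1 hα
      have hx : x ∈ closure (D.Qs k (ξ.1 k)) := by
        rw [← show D.Lam ξ = x from hs hξ]
        exact D.Lam_mem_closure hdiam ξ k
      have := D.dist_le_of_mem_closure hdiam (subset_closure hy) hx
      rw [Metric.mem_ball]
      nlinarith [mul_pos hc4 hδ])
  rw [hcard', Real.mul_rpow (by positivity) hδ.le] at hle
  have hpow := Real.rpow_pos_of_pos hδ Qd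
  have h3 := (div_lt_iff₀ hc₁).1 hN
  nlinarith [mul_lt_mul_of_pos_right h3 hpow]

end Branches

section Topology

variable {X : Type} [MetricSpace X] [MeasurableSpace X] {m : Measure X}
variable (D : ChristDecomposition m)

/-- The part of the cylinder over `α` consisting of the branches that are determined within this
cylinder by their image under `Λ`. -/
def uniqueCyl (k : ℕ) (α : D.I k) : Set D.Branch :=
  {ξ ∈ D.cyl k α | ∀ ζ ∈ D.cyl k α, D.Lam ζ = D.Lam ξ → ζ = ξ}

lemma injOn_uniqueCyl (k : ℕ) (α : D.I k) : InjOn D.Lam (D.uniqueCyl k α) :=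
  fun _ hξ _ hζ h => hζ.2 _ hξ.1 h

/-- For every large enough level `k`, a given branch lies in the corresponding `uniqueCyl`. -/
lemma eventually_mem_uniqueCyl [OpensMeasurableSpace X] [CompleteSpace X] {c₁ c₂ Qd : ℝ}
    (hc₁ : 0 < c₁) (hc₂ : 0 ≤ c₂)
    (hdiam : 0 < Metric.diam (univ : Set X)) (hreg : IsAhlfors m c₁ c₂ Qd) (ξ : D.Branch) :
    ∀ᶠ k in atTop, ξ ∈ D.uniqueCyl k (ξ.1 k) := by
  have hfin := D.finite_fiber hc₁ hc₂ hdiam hreg (D.Lam ξ)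
  have hsep : ∀ᶠ k in atTop, ∀ ζ ∈ {ζ : D.Branch | D.Lam ζ = D.Lam ξ},
      ζ.1 k = ξ.1 k → ζ = ξ := by
    rw [Filter.eventually_all_finite hfin]
    intro ζ _
    by_cases h : ζ = ξ
    · exact Eventually.of_forall fun _ _ => h
    · obtain ⟨n, hn⟩ := Branch.exists_ne h
      filter_upwards [eventually_ge_atTop n] with k hk he
      exact absurd (Branch.eq_of_le hk he) hn
  filter_upwards [hsep] with k hk
  exact ⟨rfl, fun ζ hζ he => hk ζ he hζ⟩

variable [dT : MetricSpace D.Branch]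

lemma dist_le_of_eq (hdist : ∀ ζ ξ : D.Branch, dist ζ ξ = D.rhoT ζ ξ) {ζ ξ : D.Branch} {n : ℕ}
    (h : ζ.1 n = ξ.1 n) : dist ζ ξ ≤ (2 * D.δ / (1 - D.δ)) * D.δ ^ n := by
  have h1 : 0 < 1 - D.δ := sub_pos.2 D.δ_lt_one
  have h0 := D.δ_pos
  rw [hdist, rhoT]
  split_ifs with he
  · positivity
  · obtain ⟨N, hN⟩ := Branch.exists_ne he
    have hbdd : BddAbove {k : ℕ | ζ.1 k = ξ.1 k} := ⟨N, fun k hk => by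
      by_contra hlt
      exact hN (Branch.eq_of_le (not_le.1 hlt).le hk)⟩
    exact mul_le_mul_of_nonneg_left
      (pow_le_pow_of_le_one h0.le D.δ_lt_one.le (le_csSup hbdd h)) (by positivity)

lemma eq_of_dist_lt (hdist : ∀ ζ ξ : D.Branch, dist ζ ξ = D.rhoT ζ ξ) {ζ ξ : D.Branch} {n : ℕ}
    (h : dist ζ ξ < (2 * D.δ / (1 - D.δ)) * D.δ ^ n) : ζ.1 n = ξ.1 n := by
  have h1 : 0 < 1 - D.δ := sub_pos.2 D.δ_lt_one
  have h0 := D.δ_pos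
  by_contra hn
  refine absurd h (not_lt.2 ?_)
  rw [hdist, rhoT, if_neg fun he => hn (by rw [he])]
  refine mul_le_mul_of_nonneg_left
    (pow_le_pow_of_le_one h0.le D.δ_lt_one.le ?_) (by positivity)
  refine csSup_le ⟨0, ?_⟩ fun k hk => ?_
  · exact (D.root_unique _).trans (D.root_unique _).symm
  · by_contra hlt
    exact hn (Branch.eq_of_le (not_le.1 hlt).le hk)

lemma isClosedEmbedding_val [∀ k, TopologicalSpace (D.I k)] [∀ k, DiscreteTopology (D.I k)]
    (hdist : ∀ ζ ξ : D.Branch, dist ζ ξ = D.rhoT ζ ξ) :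
    IsClosedEmbedding (fun ξ : D.Branch => ξ.1) := by
  have h1 : 0 < 1 - D.δ := sub_pos.2 D.δ_lt_one
  have h0 := D.δ_pos
  have hcont : Continuous (fun ξ : D.Branch => ξ.1) := by
    refine continuous_pi fun n => IsLocallyConstant.continuous
      ((IsLocallyConstant.iff_eventually_eq _).2 fun ξ => ?_)
    filter_upwards [Metric.ball_mem_nhds ξ
      (by positivity : 0 < (2 * D.δ / (1 - D.δ)) * D.δ ^ n)] with ζ hζ
    exact D.eq_of_dist_lt hdist hζ
  refine ⟨⟨isInducing_iff_nhds.2 fun ξ => le_antisymm hcont.continuousAt.le_comap ?_,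
    Subtype.val_injective⟩, ?_⟩
  · intro U hU
    obtain ⟨ε, hε, hsub⟩ := Metric.mem_nhds_iff.1 hU
    obtain ⟨n, hn⟩ := ((D.tendsto_scale (2 * D.δ / (1 - D.δ))).eventually_lt_const hε).exists
    refine ⟨{f | f n = ξ.1 n}, ?_, fun ζ hζ => hsub ((D.dist_le_of_eq hdist hζ).trans_lt hn)⟩
    exact ((isOpen_discrete {ξ.1 n}).preimage (continuous_apply n)).mem_nhds rfl
  · have hrange : range (fun ξ : D.Branch => ξ.1) =
        ⋂ k, (fun f : ∀ k, D.I k => (f (k + 1), f k)) ⁻¹'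
          {p | D.Qs (k + 1) p.1 ⊆ D.Qs k p.2} := by
      ext f
      simp only [mem_iInter, mem_preimage, mem_ofPred_eq]
      exact ⟨by rintro ⟨ξ, rfl⟩; exact ξ.2, fun h => ⟨⟨f, h⟩, rfl⟩⟩
    rw [hrange]
    exact isClosed_iInter fun k => (isClosed_discrete _).preimage (by fun_prop)

lemma isClopen_cyl (hdist : ∀ ζ ξ : D.Branch, dist ζ ξ = D.rhoT ζ ξ) (k : ℕ) (α : D.I k) :
    IsClopen (D.cyl k α) := by
  let _ : ∀ k, TopologicalSpace (D.I k) := fun _ => ⊥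
  have : ∀ k, DiscreteTopology (D.I k) := fun _ => ⟨rfl⟩
  exact (isClopen_discrete {α}).preimage
    ((continuous_apply k).comp (D.isClosedEmbedding_val hdist).continuous)

lemma polishSpace_branch (hdist : ∀ ζ ξ : D.Branch, dist ζ ξ = D.rhoT ζ ξ) :
    PolishSpace D.Branch := by
  let _ : ∀ k, TopologicalSpace (D.I k) := fun _ => ⊥
  have : ∀ k, DiscreteTopology (D.I k) := fun _ => ⟨rfl⟩
  have := D.countableI
  exact (D.isClosedEmbedding_val hdist).polishSpace

lemma continuous_Lam [CompleteSpace X] (hdiam : 0 < Metric.diam (univ : Set X))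
    (hdist : ∀ ζ ξ : D.Branch, dist ζ ξ = D.rhoT ζ ξ) : Continuous D.Lam := by
  refine continuous_iff_continuousAt.2 fun ξ => Metric.tendsto_nhds.2 fun ε hε => ?_
  obtain ⟨n, hn⟩ := ((D.tendsto_scale D.c₄).eventually_lt_const hε).exists
  filter_upwards [(D.isClopen_cyl hdist n (ξ.1 n)).isOpen.mem_nhds rfl] with ζ hζ
  have h1 := D.Lam_mem_closure hdiam ζ n
  rw [show ζ.1 n = ξ.1 n from hζ] at h1
  exact (D.dist_le_of_mem_closure hdiam h1 (D.Lam_mem_closure hdiam ξ n)).trans_lt hn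

variable {c₁ c₂ Qd : ℝ}

/-- Cylinders over boxes of diameter smaller than that of the whole space are compact. -/
lemma isCompact_cyl [OpensMeasurableSpace X] (hc₁ : 0 < c₁) (hc₂ : 0 ≤ c₂)
    (hdiam : 0 < Metric.diam (univ : Set X)) (hreg : IsAhlfors m c₁ c₂ Qd)
    (hdist : ∀ ζ ξ : D.Branch, dist ζ ξ = D.rhoT ζ ξ) {k : ℕ}
    (hk : D.c₄ * D.δ ^ k < Metric.diam (univ : Set X)) (α : D.I k) : IsCompact (D.cyl k α) := by
  let _ : ∀ k, TopologicalSpace (D.I k) := fun _ => ⊥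
  have : ∀ k, DiscreteTopology (D.I k) := fun _ => ⟨rfl⟩
  have hball : D.Qs k α ⊆ Metric.ball (D.z k α) (Metric.diam (univ : Set X)) := fun y hy =>
    (D.dist_le_of_mem_closure hdiam (subset_closure hy)
      (subset_closure (D.z_mem k α))).trans_lt hk
  let S : ∀ l, Set (D.I l) := fun l => {β | (l < k → D.Qs k α ⊆ D.Qs l β) ∧
    (k ≤ l → D.Qs l β ⊆ Metric.ball (D.z k α) (Metric.diam (univ : Set X)))}
  have hS : ∀ l, (S l).Finite := by
    intro l
    rcases lt_or_ge l k with hl | hl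
    · exact Set.Subsingleton.finite fun β hβ γ hγ =>
        (D.parent_unique hl α).unique (hβ.1 hl) (hγ.1 hl)
    · exact (D.finite_boxes hc₁ hc₂ hdiam hreg hdiam le_rfl (D.z k α) l).subset
        fun β hβ => hβ.2 hl
  refine ((D.isClosedEmbedding_val hdist).isCompact_preimage
    (isCompact_univ_pi fun l => (hS l).isCompact)).of_isClosed_subset
      (D.isClopen_cyl hdist k α).isClosed ?_
  rintro ξ rfl l -
  exact ⟨fun hl => ξ.antitone hl.le, fun hl => (ξ.antitone hl).trans hball⟩

lemma measurableSet_uniqueCyl [OpensMeasurableSpace X] [CompleteSpace X]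
    [MeasurableSpace D.Branch] [BorelSpace D.Branch] (hc₁ : 0 < c₁) (hc₂ : 0 ≤ c₂)
    (hdiam : 0 < Metric.diam (univ : Set X)) (hreg : IsAhlfors m c₁ c₂ Qd)
    (hdist : ∀ ζ ξ : D.Branch, dist ζ ξ = D.rhoT ζ ξ) {k : ℕ}
    (hk : D.c₄ * D.δ ^ k < Metric.diam (univ : Set X)) (α : D.I k) :
    MeasurableSet (D.uniqueCyl k α) := by
  have := D.countableI
  have hcont := D.continuous_Lam hdiam hdist
  have heq : D.uniqueCyl k α = D.cyl k α \ ⋃ (l : ℕ) (γ : D.I l),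
      ((D.cyl l γ)ᶜ ∩ D.Lam ⁻¹' (D.Lam '' (D.cyl k α ∩ D.cyl l γ))) := by
    ext ξ
    simp only [Set.mem_sdiff, mem_iUnion, not_exists]
    refine and_congr_right fun hξ => ⟨fun h l γ hmem => ?_, fun h ζ hζ he => ?_⟩
    · obtain ⟨hγ, ζ, ⟨hζ, hζγ⟩, he⟩ := hmem
      exact hγ (h ζ hζ he ▸ hζγ)
    · by_contra hne
      obtain ⟨l, hl⟩ := Branch.exists_ne hne
      exact h l (ζ.1 l) ⟨fun hc => hl (Eq.symm hc), ζ, ⟨hζ, rfl⟩, he⟩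
  rw [heq]
  refine (D.isClopen_cyl hdist k α).isOpen.measurableSet.diff
    (.iUnion fun l => .iUnion fun γ =>
      (D.isClopen_cyl hdist l γ).isOpen.measurableSet.compl.inter ?_)
  have hcpt := (D.isCompact_cyl hc₁ hc₂ hdiam hreg hdist hk α).inter_right
    (D.isClopen_cyl hdist l γ).isClosed
  exact ((hcpt.image hcont).isClosed.preimage hcont).measurableSet

/-- `∂T` is covered by countably many Borel sets on which `Λ` is injective. -/
lemma exists_cover_injOn [OpensMeasurableSpace X] [CompleteSpace X]
    [MeasurableSpace D.Branch] [BorelSpace D.Branch] (hc₁ : 0 < c₁) (hc₂ : 0 ≤ c₂)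
    (hdiam : 0 < Metric.diam (univ : Set X)) (hreg : IsAhlfors m c₁ c₂ Qd)
    (hdist : ∀ ζ ξ : D.Branch, dist ζ ξ = D.rhoT ζ ξ) :
    ∃ B : ℕ → Set D.Branch, (∀ i, MeasurableSet (B i)) ∧ (∀ i, InjOn D.Lam (B i)) ∧
      ⋃ i, B i = univ := by
  classical
  have := D.countableI
  have : Nonempty (Σ k, D.I k) := ⟨⟨0, D.root⟩⟩
  obtain ⟨f, hf⟩ := exists_surjective_nat (Σ k, D.I k)
  refine ⟨fun i => if D.c₄ * D.δ ^ (f i).1 < Metric.diam (univ : Set X) then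
    D.uniqueCyl (f i).1 (f i).2 else ∅, fun i => ?_, fun i => ?_, ?_⟩
  · dsimp only
    split_ifs with h
    · exact D.measurableSet_uniqueCyl hc₁ hc₂ hdiam hreg hdist h _
    · exact .empty
  · dsimp only
    split_ifs with h
    · exact D.injOn_uniqueCyl _ _
    · exact injOn_empty _
  · refine eq_univ_of_forall fun ξ => mem_iUnion.2 ?_
    obtain ⟨k, hk, hlt⟩ := ((D.eventually_mem_uniqueCyl hc₁ hc₂ hdiam hreg ξ).and
      ((D.tendsto_scale D.c₄).eventually_lt_const hdiam)).exists
    obtain ⟨i, hi⟩ := hf ⟨k, ξ.1 k⟩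
    refine ⟨i, ?_⟩
    rw [hi, if_pos hlt]
    exact hk

end Topology

end ChristDecomposition

end

/-- Every Borel set `A ⊆ ∂T` is a countable disjoint union of Borel sets on each
of which `Λ` is injective; moreover `Λ(A)` is Borel in `X` for every Borel `A ⊆ ∂T`. -/
theorem Lam_decomposition_and_borel_image
    {X : Type} [MetricSpace X] [CompleteSpace X] [MeasurableSpace X] [BorelSpace X]
    (m : Measure X) (c₁ c₂ Qd : ℝ)
    (hc₁ : 0 < c₁) (hc₁₂ : c₁ ≤ c₂) (hQ : 0 < Qd)
    (hdiam_pos : 0 < Metric.diam (Set.univ : Set X))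
    (hdiam_le : Metric.diam (Set.univ : Set X) ≤ 1)
    (hreg : IsAhlfors m c₁ c₂ Qd)
    (D : ChristDecomposition m)
    [dT : MetricSpace D.Branch]
    (hdist : ∀ ζ ξ : D.Branch, dist ζ ξ = D.rhoT ζ ξ)
    [MeasurableSpace D.Branch] [BorelSpace D.Branch]
    (A : Set D.Branch) (hA : MeasurableSet A) :
    (∃ Ai : ℕ → Set D.Branch,
        (∀ i : ℕ, MeasurableSet (Ai i)) ∧
        Pairwise (Function.onFun Disjoint Ai) ∧
        (⋃ i : ℕ, Ai i) = A ∧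
        ∀ i : ℕ, Set.InjOn D.Lam (Ai i)) ∧
      MeasurableSet (D.Lam '' A) := by
  have hc₂ : 0 ≤ c₂ := hc₁.le.trans hc₁₂
  obtain ⟨B, hBmeas, hBinj, hBcover⟩ := D.exists_cover_injOn hc₁ hc₂ hdiam_pos hreg hdist
  have := D.polishSpace_branch hdist
  have hcont := D.continuous_Lam hdiam_pos hdist
  have hmeas : ∀ i, MeasurableSet (A ∩ disjointed B i) := fun i =>
    hA.inter (MeasurableSet.disjointed hBmeas i)
  have hunion : ⋃ i, A ∩ disjointed B i = A := by
    rw [← inter_iUnion, iUnion_disjointed, hBcover, inter_univ]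
  have hinj : ∀ i, InjOn D.Lam (A ∩ disjointed B i) := fun i =>
    (hBinj i).mono (inter_subset_right.trans (disjointed_subset B i))
  refine ⟨⟨fun i => A ∩ disjointed B i, hmeas, fun i j hij => ?_, hunion, hinj⟩, ?_⟩
  · exact (disjoint_disjointed B hij).mono inter_subset_right inter_subset_right
  · rw [← hunion, image_iUnion]
    exact .iUnion fun i => (hmeas i).image_of_continuousOn_injOn hcont.continuousOn (hinj i)
end

section
/- There is a constant C, depending only on p, such that for every pair of positive finite Borel measures μ, σ on T̄ and every Borel function g : T̄ → [0,∞): ∫_{T̄} (M_μ g)^{p'} dσ ≤ C ∫_{T̄} g^{p'} · (M_μ σ) dμ, where M_μ g(ζ) = sup{ (∫_{S̄(β)} g dμ) / μ(S̄(β)) : β ∈ P(ζ) ∩ T, μ(S̄(β)) > 0 } and M_μ σ(ζ) = sup{ σ(S̄(β)) / μ(S̄(β)) : β ∈ P(ζ) ∩ T, μ(S̄(β)) > 0 } (each supremum taken to be 0 when the index set is empty). -/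
open MeasureTheory Set
open scoped ENNReal

/-- A countable rooted tree with at least one and at most `N` children at each vertex. -/
structure PTTree where
  V : Type
  countableV : Countable V
  root : V
  parent : V → V
  parent_root : parent root = root
  reaches_root : ∀ x : V, ∃ n : ℕ, parent^[n] x = root
  N : ℕ
  one_le_N : 1 ≤ N
  child_exists : ∀ x : V, ∃ y : V, parent y = x ∧ y ≠ x
  child_finite : ∀ x : V, {y : V | parent y = x ∧ y ≠ x}.Finite
  child_card : ∀ x : V, {y : V | parent y = x ∧ y ≠ x}.ncard ≤ N

namespace PTTree

/-- The tree order: `x ≤ y` iff `x` is an iterated parent of `y` (or `x = y`). -/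
def le (t : PTTree) (x y : t.V) : Prop := ∃ n : ℕ, t.parent^[n] y = x

/-- The predecessor set `P(x) = {y | y ≤ x}`. -/
def P (t : PTTree) (x : t.V) : Set t.V := {y : t.V | t.le y x}

/-- The successor set `S(x) = {y | y ≥ x}`. -/
def S (t : PTTree) (x : t.V) : Set t.V := {y : t.V | t.le x y}

/-- The boundary `∂T`: half-infinite geodesics starting at the root. -/
def Bdry (t : PTTree) : Type :=
  { ξ : ℕ → t.V // ξ 0 = t.root ∧ ∀ n : ℕ, t.parent (ξ (n + 1)) = ξ n }

/-- `T̄ = T ⊔ ∂T`. -/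
def Tbar (t : PTTree) : Type := t.V ⊕ t.Bdry

/-- Inclusion of vertices in `T̄`. -/
def inV (t : PTTree) (x : t.V) : t.Tbar := Sum.inl x

/-- Inclusion of boundary points in `T̄`. -/
def inB (t : PTTree) (ξ : t.Bdry) : t.Tbar := Sum.inr ξ

/-- `S̄(x) ⊆ T̄`: the successors of `x` together with the boundary geodesics through `x`. -/
def Sbar (t : PTTree) (x : t.V) : Set t.Tbar :=
  {z : t.Tbar |
    Sum.elim (fun y : t.V => t.le x y) (fun ξ : t.Bdry => ∃ n : ℕ, ξ.1 n = x) z}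

/-- The predecessor set `P(ζ) ⊆ T` of a point `ζ ∈ T̄`. -/
def PT (t : PTTree) : t.Tbar → Set t.V :=
  Sum.elim (fun x : t.V => t.P x) (fun ξ : t.Bdry => Set.range ξ.1)

/-- The compact metrizable topology on `T̄`: vertices are isolated and the sets `S̄(x)` form a
neighbourhood basis along `∂T`. -/
def top (t : PTTree) : TopologicalSpace t.Tbar :=
  TopologicalSpace.generateFrom
    ((Set.range fun x : t.V => ({t.inV x} : Set t.Tbar)) ∪ Set.range t.Sbar)

/-- The Borel σ-algebra of `T̄`. -/
def borelT (t : PTTree) : MeasurableSpace t.Tbar := @borel t.Tbar t.top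

/-- The Hardy operator `If(ζ) = Σ_{y ∈ P(ζ)} f(y)`. -/
noncomputable def Ifun (t : PTTree) (f : t.V → ℝ≥0∞) (ζ : t.Tbar) : ℝ≥0∞ :=
  ∑' y : t.PT ζ, f y.1

/-- `I*μ(x) = μ(S̄(x))`. -/
noncomputable def Istar (t : PTTree) (μ : @Measure t.Tbar t.borelT) (x : t.V) : ℝ≥0∞ :=
  μ (t.Sbar x)

/-- `Σ_{x ∈ S(a)} (I*μ(x))^{p'} π(x)^{1-p'}`, with `p' = p/(p-1)`. -/
noncomputable def sigmaSum (t : PTTree) (π : t.V → ℝ) (p : ℝ)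
    (μ : @Measure t.Tbar t.borelT) (a : t.V) : ℝ≥0∞ :=
  ∑' x : t.S a, t.Istar μ x.1 ^ (p / (p - 1)) * ENNReal.ofReal (π x.1) ^ (1 - p / (p - 1))

/-- The Carleson/testing constant
`[μ] = sup_{a : I*μ(a) > 0} (Σ_{x ∈ S(a)} (I*μ(x))^{p'} π(x)^{1-p'} / I*μ(a))^{p-1}`. -/
noncomputable def CC (t : PTTree) (π : t.V → ℝ) (p : ℝ)
    (μ : @Measure t.Tbar t.borelT) : ℝ≥0∞ :=
  ⨆ (a : t.V) (_ : 0 < t.Istar μ a), (t.sigmaSum π p μ a / t.Istar μ a) ^ (p - 1)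

/-- The tree capacity `Cap(E) = inf { Σ_x φ(x)^p π(x) : Iφ ≥ 1 on E }`. -/
noncomputable def Cap (t : PTTree) (π : t.V → ℝ) (p : ℝ) (E : Set t.Tbar) : ℝ≥0∞ :=
  ⨅ (φ : t.V → ℝ≥0∞) (_ : ∀ ζ ∈ E, 1 ≤ t.Ifun φ ζ),
    ∑' x : t.V, φ x ^ p * ENNReal.ofReal (π x)

/-- The potential-theoretic distance from the root
`d_π(ζ) = Σ_{y ∈ P(ζ)} π(y)^{1-p'}`. -/
noncomputable def dpi (t : PTTree) (π : t.V → ℝ) (p : ℝ) (ζ : t.Tbar) : ℝ≥0∞ :=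
  ∑' y : t.PT ζ, ENNReal.ofReal (π y.1) ^ (1 - p / (p - 1))

/-- The tree maximal function `M_μ g(ζ) = sup_{β ∈ P(ζ), μ(S̄(β)) > 0} (∫_{S̄(β)} g dμ) / μ(S̄(β))`. -/
noncomputable def Mfun (t : PTTree) (μ : @Measure t.Tbar t.borelT)
    (g : t.Tbar → ℝ≥0∞) (ζ : t.Tbar) : ℝ≥0∞ :=
  ⨆ (β : t.V) (_ : β ∈ t.PT ζ) (_ : 0 < μ (t.Sbar β)),
    (∫⁻ z in t.Sbar β, g z ∂μ) / μ (t.Sbar β)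

/-- The tree maximal function of a measure,
`M_μ σ(ζ) = sup_{β ∈ P(ζ), μ(S̄(β)) > 0} σ(S̄(β)) / μ(S̄(β))`. -/
noncomputable def Mmeas (t : PTTree) (μ σ : @Measure t.Tbar t.borelT)
    (ζ : t.Tbar) : ℝ≥0∞ :=
  ⨆ (β : t.V) (_ : β ∈ t.PT ζ) (_ : 0 < μ (t.Sbar β)), σ (t.Sbar β) / μ (t.Sbar β)

end PTTree

section MaximalInequality

namespace PTTree

attribute [local instance] PTTree.borelT

variable (t : PTTree)

theorem mem_PT_iff (β : t.V) (ζ : t.Tbar) : β ∈ t.PT ζ ↔ ζ ∈ t.Sbar β := by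
  cases ζ <;> exact Iff.rfl

theorem measurableSet_Sbar (β : t.V) : MeasurableSet (t.Sbar β) :=
  MeasurableSpace.measurableSet_generateFrom
    (TopologicalSpace.isOpen_generateFrom_of_mem (Or.inr ⟨β, rfl⟩))

theorem le_or_le_of_mem_Sbar {α β : t.V} {ζ : t.Tbar} (hα : ζ ∈ t.Sbar α)
    (hβ : ζ ∈ t.Sbar β) : t.le α β ∨ t.le β α := by
  have iterate_comparable : ∀ (y : t.V) (m n : ℕ), m ≤ n →
      t.le (t.parent^[n] y) (t.parent^[m] y) := fun y m n h =>
    ⟨n - m, by rw [← Function.iterate_add_apply, Nat.sub_add_cancel h]⟩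
  cases ζ with
  | inl y =>
    obtain ⟨m, rfl⟩ := hα
    obtain ⟨n, rfl⟩ := hβ
    rcases le_total m n with h | h
    · exact Or.inr (iterate_comparable y m n h)
    · exact Or.inl (iterate_comparable y n m h)
  | inr ξ =>
    have key : ∀ k m : ℕ, t.parent^[k] (ξ.1 (m + k)) = ξ.1 m := by
      intro k
      induction k with
      | zero => intro m; rfl
      | succ k ih => intro m; rw [Function.iterate_succ_apply, ← add_assoc, ξ.2.2, ih]
    obtain ⟨m, rfl⟩ := hα
    obtain ⟨n, rfl⟩ := hβ
    rcases le_total m n with h | h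
    · exact Or.inl ⟨n - m, by simpa [Nat.add_sub_cancel' h] using key (n - m) m⟩
    · exact Or.inr ⟨m - n, by simpa [Nat.add_sub_cancel' h] using key (m - n) n⟩

theorem Sbar_subset_of_le {α β : t.V} (h : t.le α β) : t.Sbar β ⊆ t.Sbar α := by
  obtain ⟨k, rfl⟩ := h
  intro ζ hζ
  cases ζ with
  | inl y =>
    obtain ⟨n, rfl⟩ := hζ
    exact ⟨k + n, Function.iterate_add_apply _ _ _ _⟩
  | inr ξ =>
    obtain ⟨n, rfl⟩ := hζ
    change ∃ m, ξ.1 m = t.parent^[k] (ξ.1 n)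
    induction k with
    | zero => exact ⟨n, rfl⟩
    | succ k ih =>
      obtain ⟨m, hm⟩ := ih
      rw [Function.iterate_succ_apply', ← hm]
      cases m with
      | zero => exact ⟨0, by rw [ξ.2.1, t.parent_root]⟩
      | succ m => exact ⟨m, (ξ.2.2 m).symm⟩

/-- Elements of `B` with no other element of `B` below them in the tree order. -/
def minimals (B : Set t.V) : Set t.V := {α | α ∈ B ∧ ∀ α' ∈ B, t.le α' α → α' = α}

theorem exists_le_mem_minimals (B : Set t.V) {β : t.V} (hβ : β ∈ B) :
    ∃ α ∈ t.minimals B, t.le α β := by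
  obtain ⟨n, hn⟩ := t.reaches_root β
  induction n using Nat.strong_induction_on generalizing β with
  | _ n ih =>
    by_cases hmin : ∀ α' ∈ B, t.le α' β → α' = β
    · exact ⟨β, ⟨hβ, hmin⟩, 0, rfl⟩
    · push Not at hmin
      obtain ⟨α', hα', ⟨m, rfl⟩, hne⟩ := hmin
      have root_fixed : ∀ k, t.parent^[k] t.root = t.root :=
        fun k => Function.iterate_fixed t.parent_root k
      have hm : m ≠ 0 := by rintro rfl; exact hne rfl
      have hn0 : n ≠ 0 := by
        rintro rfl
        have hroot : β = t.root := hn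
        exact hne (by rw [hroot, root_fixed])
      have hreach : t.parent^[n - m] (t.parent^[m] β) = t.root := by
        rw [← Function.iterate_add_apply]
        obtain ⟨k, hk⟩ : ∃ k, n - m + m = k + n := ⟨n - m + m - n, by omega⟩
        rw [hk, Function.iterate_add_apply, hn, root_fixed]
      obtain ⟨α, hα, j, hj⟩ := ih (n - m) (by omega) hα' hreach
      exact ⟨α, hα, j + m, by rw [Function.iterate_add_apply, hj]⟩

theorem pairwise_disjoint_Sbar_minimals (B : Set t.V) :
    Pairwise (Function.onFun Disjoint fun β : t.minimals B => t.Sbar β.1) := by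
  intro α β hne
  refine Set.disjoint_left.2 fun ζ hα hβ => hne (Subtype.ext ?_)
  rcases t.le_or_le_of_mem_Sbar hα hβ with h | h
  · exact β.2.2 _ α.2.1 h
  · exact (α.2.2 _ β.2.1 h).symm

theorem measurable_iSup_Sbar (c : t.V → ℝ≥0∞) (Q : t.V → Prop) :
    Measurable fun ζ : t.Tbar => ⨆ (β : t.V) (_ : β ∈ t.PT ζ) (_ : Q β), c β := by
  classical
  have := t.countableV
  have heq : (fun ζ : t.Tbar => ⨆ (β : t.V) (_ : β ∈ t.PT ζ) (_ : Q β), c β) =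
      fun ζ => ⨆ β : t.V, (t.Sbar β).indicator (fun _ => ⨆ _ : Q β, c β) ζ := by
    funext ζ
    refine iSup_congr fun β => ?_
    by_cases h : ζ ∈ t.Sbar β
    · simp [mem_PT_iff, h]
    · simp [mem_PT_iff, h]
  rw [heq]
  exact Measurable.iSup fun β => measurable_const.indicator (t.measurableSet_Sbar β)

variable (μ σ : Measure t.Tbar)

theorem measurable_Mfun (g : t.Tbar → ℝ≥0∞) : Measurable (t.Mfun μ g) :=
  t.measurable_iSup_Sbar _ _

theorem measurable_Mmeas : Measurable (t.Mmeas μ σ) :=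
  t.measurable_iSup_Sbar _ _

theorem lt_Mfun_iff {g : t.Tbar → ℝ≥0∞} {a : ℝ≥0∞} {ζ : t.Tbar} :
    a < t.Mfun μ g ζ ↔ ∃ β : t.V, ζ ∈ t.Sbar β ∧ 0 < μ (t.Sbar β) ∧
      a < (∫⁻ z in t.Sbar β, g z ∂μ) / μ (t.Sbar β) := by
  simp only [Mfun, lt_iSup_iff, mem_PT_iff, exists_prop]

/-- The weak type `(1, 1)` inequality. -/
theorem mul_measure_lt_Mfun_le [IsFiniteMeasure μ] (g : t.Tbar → ℝ≥0∞) (a : ℝ≥0∞) :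
    a * σ {ζ | a < t.Mfun μ g ζ} ≤ ∫⁻ ζ, t.Mmeas μ σ ζ * g ζ ∂μ := by
  have := t.countableV
  set B : Set t.V := {β | 0 < μ (t.Sbar β) ∧
    a < (∫⁻ z in t.Sbar β, g z ∂μ) / μ (t.Sbar β)} with hB
  have hcover : {ζ | a < t.Mfun μ g ζ} ⊆ ⋃ β : t.minimals B, t.Sbar β.1 := by
    intro ζ hζ
    obtain ⟨β, hζβ, hβ⟩ := (t.lt_Mfun_iff μ).1 hζ
    obtain ⟨α, hα, hle⟩ := t.exists_le_mem_minimals B (β := β) hβ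
    exact Set.mem_iUnion.2 ⟨⟨α, hα⟩, t.Sbar_subset_of_le hle hζβ⟩
  have hterm : ∀ β : t.minimals B,
      a * σ (t.Sbar β.1) ≤ ∫⁻ ζ in t.Sbar β.1, t.Mmeas μ σ ζ * g ζ ∂μ := by
    rintro ⟨β, ⟨hpos, hlt⟩, -⟩
    have hfin : σ (t.Sbar β) / μ (t.Sbar β) ≤ ⨅ ζ ∈ t.Sbar β, t.Mmeas μ σ ζ :=
      le_iInf₂ fun ζ hζ =>
        le_iSup_of_le β (le_iSup_of_le ((t.mem_PT_iff β ζ).2 hζ) (le_iSup_of_le hpos le_rfl))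
    calc a * σ (t.Sbar β)
        ≤ (∫⁻ z in t.Sbar β, g z ∂μ) / μ (t.Sbar β) * σ (t.Sbar β) := by gcongr
      _ = σ (t.Sbar β) / μ (t.Sbar β) * ∫⁻ z in t.Sbar β, g z ∂μ := by
          simp only [div_eq_mul_inv]; ring
      _ ≤ ∫⁻ z in t.Sbar β, σ (t.Sbar β) / μ (t.Sbar β) * g z ∂μ := lintegral_const_mul_le _ _
      _ ≤ ∫⁻ ζ in t.Sbar β, t.Mmeas μ σ ζ * g ζ ∂μ :=
          setLIntegral_mono' (t.measurableSet_Sbar β) fun ζ hζ =>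
            mul_le_mul_left (hfin.trans (iInf₂_le ζ hζ)) _
  calc a * σ {ζ | a < t.Mfun μ g ζ}
      ≤ a * ∑' β : t.minimals B, σ (t.Sbar β.1) := by
        gcongr
        exact (measure_mono hcover).trans (measure_iUnion_le _)
    _ = ∑' β : t.minimals B, a * σ (t.Sbar β.1) := ENNReal.tsum_mul_left.symm
    _ ≤ ∑' β : t.minimals B, ∫⁻ ζ in t.Sbar β.1, t.Mmeas μ σ ζ * g ζ ∂μ :=
        ENNReal.tsum_le_tsum hterm
    _ = ∫⁻ ζ in ⋃ β : t.minimals B, t.Sbar β.1, t.Mmeas μ σ ζ * g ζ ∂μ :=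
        (lintegral_iUnion (fun β : t.minimals B => t.measurableSet_Sbar β.1)
          (t.pairwise_disjoint_Sbar_minimals B) _).symm
    _ ≤ ∫⁻ ζ, t.Mmeas μ σ ζ * g ζ ∂μ := setLIntegral_le_lintegral _ _

/-- The weak type inequality, with only the large values of `g` on the right-hand side. -/
theorem mul_measure_add_lt_Mfun_le [IsFiniteMeasure μ] {g : t.Tbar → ℝ≥0∞} (hg : Measurable g)
    {a : ℝ≥0∞} (ha : a ≠ ∞) :
    a * σ {ζ | a + a < t.Mfun μ g ζ} ≤
      ∫⁻ ζ in {ζ | a < g ζ}, t.Mmeas μ σ ζ * g ζ ∂μ := by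
  have hs : MeasurableSet {ζ | a < g ζ} := measurableSet_lt measurable_const hg
  have hle : ∀ ζ, g ζ ≤ a + {ζ | a < g ζ}.indicator g ζ := by
    intro ζ
    by_cases h : a < g ζ
    · simp [h]
    · exact (not_lt.1 h).trans le_self_add
  have hsub : {ζ | a + a < t.Mfun μ g ζ} ⊆
      {ζ | a < t.Mfun μ ({ζ | a < g ζ}.indicator g) ζ} := by
    intro ζ hζ
    obtain ⟨β, hζβ, hpos, hlt⟩ := (t.lt_Mfun_iff μ).1 hζ
    refine (t.lt_Mfun_iff μ).2 ⟨β, hζβ, hpos, ?_⟩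
    have havg : (∫⁻ z in t.Sbar β, g z ∂μ) / μ (t.Sbar β) ≤
        a + (∫⁻ z in t.Sbar β, {ζ | a < g ζ}.indicator g z ∂μ) / μ (t.Sbar β) := by
      calc (∫⁻ z in t.Sbar β, g z ∂μ) / μ (t.Sbar β)
          ≤ (∫⁻ z in t.Sbar β, (a + {ζ | a < g ζ}.indicator g z) ∂μ) / μ (t.Sbar β) := by
            gcongr with z; exact hle z
        _ = a + (∫⁻ z in t.Sbar β, {ζ | a < g ζ}.indicator g z ∂μ) / μ (t.Sbar β) := by
            rw [lintegral_add_left measurable_const, setLIntegral_const, ENNReal.add_div,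
              ENNReal.mul_div_cancel_right hpos.ne' (measure_ne_top _ _)]
    exact (ENNReal.add_lt_add_iff_left ha).1 (hlt.trans_le havg)
  calc a * σ {ζ | a + a < t.Mfun μ g ζ}
      ≤ a * σ {ζ | a < t.Mfun μ ({ζ | a < g ζ}.indicator g) ζ} := by gcongr
    _ ≤ ∫⁻ ζ, t.Mmeas μ σ ζ * {ζ | a < g ζ}.indicator g ζ ∂μ :=
        t.mul_measure_lt_Mfun_le μ σ _ a
    _ = ∫⁻ ζ in {ζ | a < g ζ}, t.Mmeas μ σ ζ * g ζ ∂μ := by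
        rw [← lintegral_indicator hs]
        refine lintegral_congr fun ζ => ?_
        by_cases h : a < g ζ <;> simp [h]

theorem Mfun_le_of_le [IsFiniteMeasure μ] {g : t.Tbar → ℝ≥0∞} {c : ℝ≥0∞} (hg : ∀ ζ, g ζ ≤ c)
    (ζ : t.Tbar) : t.Mfun μ g ζ ≤ c := by
  refine iSup_le fun β => iSup_le fun _ => iSup_le fun hpos => ?_
  refine ENNReal.div_le_of_le_mul ?_
  calc ∫⁻ z in t.Sbar β, g z ∂μ ≤ ∫⁻ _ in t.Sbar β, c ∂μ := lintegral_mono hg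
    _ = c * μ (t.Sbar β) := setLIntegral_const _ _

theorem Mfun_iSup {g : ℕ → t.Tbar → ℝ≥0∞} (hg : ∀ n, Measurable (g n)) (hmono : Monotone g)
    (ζ : t.Tbar) : t.Mfun μ (fun z => ⨆ n, g n z) ζ = ⨆ n, t.Mfun μ (g n) ζ := by
  simp only [Mfun, lintegral_iSup hg hmono, ENNReal.iSup_div]
  refine Eq.trans (iSup_congr fun β => ?_) iSup_comm
  exact Eq.trans (iSup_congr fun _ => iSup_comm) iSup_comm

theorem Mfun_mono {f g : t.Tbar → ℝ≥0∞} (h : f ≤ g) : t.Mfun μ f ≤ t.Mfun μ g := by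
  intro ζ
  unfold Mfun
  gcongr with β hβ hpos z
  exact h z

end PTTree

/-- Integrating a weak type bound on the distribution functions. -/
theorem lintegral_rpow_le_of_mul_measure_lt_le {α : Type*} [MeasurableSpace α]
    {σ ν : Measure α} {F G : α → ℝ} (hF : Measurable F) (hG : Measurable G) (hF0 : ∀ x, 0 ≤ F x)
    (hG0 : ∀ x, 0 ≤ G x) {c : ℝ≥0∞} (hc : c ≠ ∞)
    (h : ∀ s : ℝ, 0 < s → ENNReal.ofReal s * σ {x | s < F x} ≤ c * ν {x | s < G x})
    {q : ℝ} (hq : 1 < q) :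
    ∫⁻ x, ENNReal.ofReal (F x ^ q) ∂σ ≤
      c * ENNReal.ofReal (q / (q - 1)) * ∫⁻ x, ENNReal.ofReal (G x ^ (q - 1)) ∂ν := by
  have hq1 : 0 < q - 1 := by linarith
  rw [lintegral_rpow_eq_lintegral_meas_lt_mul σ (.of_forall hF0) hF.aemeasurable (by linarith),
    lintegral_rpow_eq_lintegral_meas_lt_mul ν (.of_forall hG0) hG.aemeasurable hq1]
  have hint : ∫⁻ s in Set.Ioi (0 : ℝ), σ {x | s < F x} * ENNReal.ofReal (s ^ (q - 1)) ≤
      c * ∫⁻ s in Set.Ioi (0 : ℝ), ν {x | s < G x} * ENNReal.ofReal (s ^ (q - 1 - 1)) := by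
    rw [← lintegral_const_mul' _ _ hc]
    refine setLIntegral_mono' measurableSet_Ioi fun s hs => ?_
    have hs' : (0 : ℝ) < s := hs
    have hpow : s ^ (q - 1) = s * s ^ (q - 1 - 1) := by
      rw [Real.rpow_sub_one hs'.ne' (q - 1)]; field_simp
    rw [hpow, ENNReal.ofReal_mul hs'.le, ← mul_assoc, ← mul_assoc, mul_comm (σ _)]
    exact mul_le_mul_left (h s hs') _
  have hconst : ENNReal.ofReal (q / (q - 1)) * ENNReal.ofReal (q - 1) = ENNReal.ofReal q := by
    rw [← ENNReal.ofReal_mul (by positivity), div_mul_cancel₀ _ hq1.ne']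
  calc _ ≤ ENNReal.ofReal q * (c * ∫⁻ s in Set.Ioi (0 : ℝ),
          ν {x | s < G x} * ENNReal.ofReal (s ^ (q - 1 - 1))) := by gcongr
    _ = _ := by rw [← hconst]; ring

namespace PTTree

attribute [local instance] PTTree.borelT

variable (t : PTTree) (μ σ : Measure t.Tbar)

theorem lintegral_Mfun_rpow_le_of_bounded [IsFiniteMeasure μ] {g : t.Tbar → ℝ≥0∞}
    (hg : Measurable g) {c : ℝ≥0∞} (hc : c ≠ ∞) (hgc : ∀ ζ, g ζ ≤ c) {q : ℝ} (hq : 1 < q) :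
    ∫⁻ ζ, t.Mfun μ g ζ ^ q ∂σ ≤
      ENNReal.ofReal (2 ^ q * (q / (q - 1))) * ∫⁻ ζ, g ζ ^ q * t.Mmeas μ σ ζ ∂μ := by
  have hq1 : 0 < q - 1 := by linarith
  have hgtop : ∀ ζ, g ζ ≠ ∞ := fun ζ => ne_top_of_le_ne_top hc (hgc ζ)
  have hMtop : ∀ ζ, t.Mfun μ g ζ ≠ ∞ := fun ζ =>
    ne_top_of_le_ne_top hc (t.Mfun_le_of_le μ hgc ζ)
  have hw : Measurable fun ζ => t.Mmeas μ σ ζ * g ζ := (t.measurable_Mmeas μ σ).mul hg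
  have key := lintegral_rpow_le_of_mul_measure_lt_le (σ := σ)
    (ν := μ.withDensity fun ζ => t.Mmeas μ σ ζ * g ζ)
    (F := fun ζ => (t.Mfun μ g ζ).toReal) (G := fun ζ => 2 * (g ζ).toReal)
    (t.measurable_Mfun μ g).ennreal_toReal (hg.ennreal_toReal.const_mul 2)
    (fun _ => ENNReal.toReal_nonneg) (fun _ => by positivity) (c := 2) (by simp) ?_ hq
  · have hpoint : ∀ ζ, (t.Mmeas μ σ ζ * g ζ) * ENNReal.ofReal ((2 * (g ζ).toReal) ^ (q - 1)) =
        ENNReal.ofReal (2 ^ (q - 1)) * (g ζ ^ q * t.Mmeas μ σ ζ) := by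
      intro ζ
      have hpow : g ζ ^ q = g ζ ^ (q - 1) * g ζ := by
        conv_lhs => rw [← sub_add_cancel q 1]
        rw [ENNReal.rpow_add_of_nonneg _ _ hq1.le zero_le_one, ENNReal.rpow_one]
      rw [Real.mul_rpow (by norm_num) ENNReal.toReal_nonneg, ENNReal.ofReal_mul (by positivity),
        ← ENNReal.ofReal_rpow_of_nonneg ENNReal.toReal_nonneg hq1.le,
        ENNReal.ofReal_toReal (hgtop ζ), hpow]
      ring
    have hleft : ∀ ζ, ENNReal.ofReal ((t.Mfun μ g ζ).toReal ^ q) = t.Mfun μ g ζ ^ q := by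
      intro ζ
      rw [← ENNReal.ofReal_rpow_of_nonneg ENNReal.toReal_nonneg (by linarith),
        ENNReal.ofReal_toReal (hMtop ζ)]
    have hconst : ENNReal.ofReal (2 ^ q * (q / (q - 1))) =
        2 * ENNReal.ofReal (q / (q - 1)) * ENNReal.ofReal (2 ^ (q - 1)) := by
      rw [← ENNReal.ofReal_ofNat 2, ← ENNReal.ofReal_mul (by norm_num),
        ← ENNReal.ofReal_mul (by positivity), Real.rpow_sub_one (by norm_num)]
      congr 1
      ring
    rw [lintegral_withDensity_eq_lintegral_mul _ hw
      ((hg.ennreal_toReal.const_mul 2).pow_const _).ennreal_ofReal] at key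
    simp only [Pi.mul_apply, hpoint, hleft] at key
    rw [lintegral_const_mul' _ _ ENNReal.ofReal_ne_top, ← mul_assoc, ← hconst] at key
    exact key
  · intro s hs
    have hs2 : 0 ≤ s / 2 := by positivity
    have hsum : ENNReal.ofReal (s / 2) + ENNReal.ofReal (s / 2) = ENNReal.ofReal s := by
      rw [← ENNReal.ofReal_add hs2 hs2, add_halves]
    have hweak := t.mul_measure_add_lt_Mfun_le μ σ hg (a := ENNReal.ofReal (s / 2))
      ENNReal.ofReal_ne_top
    have hFset : {ζ | s < (t.Mfun μ g ζ).toReal} = {ζ | ENNReal.ofReal s < t.Mfun μ g ζ} := by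
      ext ζ
      exact (ENNReal.ofReal_lt_iff_lt_toReal hs.le (hMtop ζ)).symm
    have hGset : {ζ | s < 2 * (g ζ).toReal} = {ζ | ENNReal.ofReal (s / 2) < g ζ} := by
      ext ζ
      simp only [Set.mem_ofPred_eq, ENNReal.ofReal_lt_iff_lt_toReal hs2 (hgtop ζ)]
      constructor <;> intro h <;> linarith
    rw [hsum] at hweak
    rw [hFset, hGset, withDensity_apply _ (measurableSet_lt measurable_const hg), ← hsum,
      ← two_mul, mul_assoc, two_mul (ENNReal.ofReal (s / 2)), hsum]
    gcongr

theorem lintegral_Mfun_rpow_le [IsFiniteMeasure μ] {g : t.Tbar → ℝ≥0∞}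
    (hg : Measurable g) {q : ℝ} (hq : 1 < q) :
    ∫⁻ ζ, t.Mfun μ g ζ ^ q ∂σ ≤
      ENNReal.ofReal (2 ^ q * (q / (q - 1))) * ∫⁻ ζ, g ζ ^ q * t.Mmeas μ σ ζ ∂μ := by
  have hq0 : 0 < q := by linarith
  set f : ℕ → t.Tbar → ℝ≥0∞ := fun n ζ => min (g ζ) n with hf
  have hfm : ∀ n, Measurable (f n) := fun n => hg.min measurable_const
  have hmono : Monotone f := fun m n hmn ζ => min_le_min_left _ (by exact_mod_cast hmn)
  have hsup : g = fun ζ => ⨆ n, f n ζ := by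
    funext ζ
    simp only [hf, ← inf_iSup_eq, ENNReal.iSup_natCast]
    simp
  have hMsup : ∀ ζ, t.Mfun μ g ζ ^ q = ⨆ n, t.Mfun μ (f n) ζ ^ q := by
    intro ζ
    conv_lhs => rw [hsup, t.Mfun_iSup μ hfm hmono]
    exact (ENNReal.orderIsoRpow q hq0).map_iSup _
  simp only [hMsup]
  rw [lintegral_iSup (fun n => (t.measurable_Mfun μ (f n)).pow_const q) fun m n hmn ζ =>
    ENNReal.rpow_le_rpow (t.Mfun_mono μ (hmono hmn) ζ) hq0.le]
  refine iSup_le fun n => (t.lintegral_Mfun_rpow_le_of_bounded μ σ (hfm n)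
    (ENNReal.natCast_ne_top n) (fun ζ => min_le_right _ _) hq).trans ?_
  gcongr with ζ
  exact min_le_left _ _

end PTTree

end MaximalInequality

/-- maximal function inequality on trees: there is `C` depending only on `p`
such that for all positive finite Borel measures `μ, σ` on `T̄` and all Borel `g ≥ 0`:
`∫ (M_μ g)^{p'} dσ ≤ C ∫ g^{p'} (M_μ σ) dμ`. -/
theorem tree_maximal_inequality (p : ℝ) (hp : 1 < p) :
    ∃ C : ℝ, 0 < C ∧
      ∀ (t : PTTree) (μ σ : @Measure t.Tbar t.borelT),
        IsFiniteMeasure μ → IsFiniteMeasure σ →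
        ∀ g : t.Tbar → ℝ≥0∞, @Measurable t.Tbar ℝ≥0∞ t.borelT ENNReal.measurableSpace g →
          ∫⁻ ζ, t.Mfun μ g ζ ^ (p / (p - 1)) ∂σ ≤
            ENNReal.ofReal C * ∫⁻ ζ, g ζ ^ (p / (p - 1)) * t.Mmeas μ σ ζ ∂μ := by
  have hp1 : 0 < p - 1 := by linarith
  have hq : 1 < p / (p - 1) := by rw [lt_div_iff₀ hp1]; linarith
  have hq1 : 0 < p / (p - 1) - 1 := by linarith
  refine ⟨2 ^ (p / (p - 1)) * (p / (p - 1) / (p / (p - 1) - 1)), by positivity, ?_⟩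
  intro t μ σ hμ _ g hg
  let := t.borelT
  exact t.lintegral_Mfun_rpow_le μ σ hg hq
end
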